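/- For every ℓ > 0 there exists a constant C = C(ℓ) > 0 such that for every smooth map u : ℝ × ℝ → ℝ³, ℓ-periodic in the second variable, with |u(t,s)| = 1 everywhere and solving ∂ₜu = ∂ₛ(u × ∂ₛu), and for every t ∈ ℝ, (d/dt)( ∫₀^ℓ |∂ₛₛₛu(t,s)|² ds + ∫₀^ℓ |∂ₜₛu(t,s)|² ds ) ≤ C · (∫₀^ℓ |∂ₛₛu(t,s)|² ds) · ( ∫₀^ℓ |∂ₛₛₛu(t,s)|² ds + ∫₀^ℓ |∂ₜₛu(t,s)|² ds ). -/

import Mathlib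

noncomputable section
open Real MeasureTheory

/-- `ℝ³` as Euclidean space. -/
abbrev R3 : Type := EuclideanSpace ℝ (Fin 3)

/-- Pack three real numbers into a vector of `ℝ³`. -/
def toE (v : Fin 3 → ℝ) : R3 := (EuclideanSpace.equiv (Fin 3) ℝ).symm v

/-- The cross product on `ℝ³`. -/
def cross3 (a b : R3) : R3 :=
  toE ![a 1 * b 2 - a 2 * b 1, a 2 * b 0 - a 0 * b 2, a 0 * b 1 - a 1 * b 0]



open scoped ContDiff

lemma inner_R3 (x y : R3) : inner ℝ x y = x 0 * y 0 + x 1 * y 1 + x 2 * y 2 := by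
  simp [PiLp.inner_apply, Fin.sum_univ_three]; ring

lemma cross3_0 (a b : R3) : cross3 a b 0 = a 1 * b 2 - a 2 * b 1 := by
  simp [cross3, toE]
lemma cross3_1 (a b : R3) : cross3 a b 1 = a 2 * b 0 - a 0 * b 2 := by
  simp [cross3, toE]
lemma cross3_2 (a b : R3) : cross3 a b 2 = a 0 * b 1 - a 1 * b 0 := by
  simp [cross3, toE]

lemma R3_ext {x y : R3} (h0 : x 0 = y 0) (h1 : x 1 = y 1) (h2 : x 2 = y 2) : x = y := by
  ext i; fin_cases i <;> assumption

lemma norm_cross3_le (a b : R3) : ‖cross3 a b‖ ≤ ‖a‖ * ‖b‖ := by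
  apply le_of_sq_le_sq _ (by positivity)
  have e : ∀ x : R3, ‖x‖ ^ 2 = x 0 * x 0 + x 1 * x 1 + x 2 * x 2 := fun x => by
    rw [← inner_R3, real_inner_self_eq_norm_sq]
  rw [mul_pow, e, e, e, cross3_0, cross3_1, cross3_2]
  nlinarith [sq_nonneg (a 0 * b 0 + a 1 * b 1 + a 2 * b 2)]

lemma HasDerivAt.R3_coord {f : ℝ → R3} {f' : R3} {x : ℝ} (h : HasDerivAt f f' x) (i : Fin 3) :
    HasDerivAt (fun y => f y i) (f' i) x :=
  (EuclideanSpace.proj (𝕜 := ℝ) i : R3 →L[ℝ] ℝ).hasFDerivAt.comp_hasDerivAt x h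

lemma HasDerivAt.of_R3_coord {f : ℝ → R3} {f' : R3} {x : ℝ}
    (h : ∀ i, HasDerivAt (fun y => f y i) (f' i) x) : HasDerivAt f f' x :=
  (EuclideanSpace.equiv (Fin 3) ℝ).symm.hasFDerivAt.comp_hasDerivAt x
    (hasDerivAt_pi.2 h : HasDerivAt (fun y i => f y i) (fun i => f' i) x)

lemma HasDerivAt.cross3 {f g : ℝ → R3} {f' g' : R3} {x : ℝ} (hf : HasDerivAt f f' x)
    (hg : HasDerivAt g g' x) :
    HasDerivAt (fun y => _root_.cross3 (f y) (g y))
      (_root_.cross3 (f x) g' + _root_.cross3 f' (g x)) x := by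
  apply HasDerivAt.of_R3_coord
  intro i
  fin_cases i
  · simp only [Fin.zero_eta, PiLp.add_apply, cross3_0]
    refine (((hf.R3_coord 1).fun_mul (hg.R3_coord 2)).fun_sub ((hf.R3_coord 2).fun_mul (hg.R3_coord 1))).congr_deriv ?_
    ring
  · simp only [Fin.mk_one, PiLp.add_apply, cross3_1]
    refine (((hf.R3_coord 2).fun_mul (hg.R3_coord 0)).fun_sub ((hf.R3_coord 0).fun_mul (hg.R3_coord 2))).congr_deriv ?_
    ring
  · simp only [Fin.reduceFinMk, PiLp.add_apply, cross3_2]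
    refine (((hf.R3_coord 0).fun_mul (hg.R3_coord 1)).fun_sub ((hf.R3_coord 1).fun_mul (hg.R3_coord 0))).congr_deriv ?_
    ring

lemma abs_inner_cross_le (x y z : R3) : |inner ℝ x (cross3 y z)| ≤ ‖x‖ * (‖y‖ * ‖z‖) :=
  (abs_real_inner_le_norm _ _).trans
    (mul_le_mul_of_nonneg_left (norm_cross3_le y z) (norm_nonneg _))

lemma alg1 (u a b c d e : R3) :
    2 * inner ℝ c (cross3 u e + (3 : ℝ) • cross3 a d + (2 : ℝ) • cross3 b c) =
      2 * (inner ℝ d (cross3 u d) + inner ℝ c (cross3 a d) + inner ℝ c (cross3 u e))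
        + 4 * inner ℝ c (cross3 a d) := by
  simp only [inner_R3, PiLp.add_apply, PiLp.smul_apply, smul_eq_mul, cross3_0, cross3_1, cross3_2]
  ring

lemma alg2 (u a b c v w ws wss : R3) :
    2 * inner ℝ w (cross3 w b + cross3 v c + cross3 a ws + cross3 u wss) =
      2 * (inner ℝ ws (cross3 u ws) + inner ℝ w (cross3 a ws) + inner ℝ w (cross3 u wss))
        + 2 * inner ℝ w (cross3 v c) := by
  simp only [inner_R3, PiLp.add_apply, cross3_0, cross3_1, cross3_2]
  ring

lemma alg3 (u a c d : R3) (h1 : inner ℝ u u = (1 : ℝ)) (h2 : inner ℝ u a = (0 : ℝ)) :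
    inner ℝ c (cross3 a d) = inner ℝ u c * inner ℝ u (cross3 a d)
      - inner ℝ u d * inner ℝ u (cross3 a c) := by
  have key : inner ℝ c (cross3 a d) * inner ℝ u u = inner ℝ u c * inner ℝ u (cross3 a d)
      - inner ℝ u d * inner ℝ u (cross3 a c) + inner ℝ u a * inner ℝ c (cross3 u d) := by
    simp only [inner_R3, cross3_0, cross3_1, cross3_2]
    ring
  rw [h1, h2] at key
  linarith

lemma alg4 (u b c w : R3) :
    inner ℝ w (cross3 (cross3 u b) c) = inner ℝ u c * inner ℝ w b - inner ℝ b c * inner ℝ u w := by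
  simp only [inner_R3, cross3_0, cross3_1, cross3_2]
  ring

lemma alg5 (u a b c : R3) :
    inner ℝ u (cross3 u c + cross3 a b) = inner ℝ u (cross3 a b) := by
  simp only [inner_R3, PiLp.add_apply, cross3_0, cross3_1, cross3_2]
  ring

/-- The flux derivative, bounding the density derivative. -/
def fluxD (u a b c d e w ws wss : R3) : ℝ :=
  2 * (inner ℝ d (cross3 u d) + inner ℝ c (cross3 a d) + inner ℝ c (cross3 u e))
  + 2 * (inner ℝ ws (cross3 u ws) + inner ℝ w (cross3 a ws) + inner ℝ w (cross3 u wss))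
  - 12 * ((inner ℝ b b + inner ℝ a c) * inner ℝ u (cross3 a c)
     + inner ℝ a b * (inner ℝ u (cross3 b c) + inner ℝ u (cross3 a d)))
  + 44 * ((2 * inner ℝ b c) * inner ℝ a b + inner ℝ b b * (inner ℝ b b + inner ℝ a c))

lemma real_ineq (A B C W : ℝ) :
    38 * (A * B ^ 2 * C) + 28 * (A ^ 2 * C ^ 2) + 6 * (A * B ^ 2 * W)
     ≤ 22 * B ^ 4 + 47 * (A ^ 2 * C ^ 2) + 3 * (A ^ 2 * W ^ 2) := by
  nlinarith [sq_nonneg (B ^ 2 - A * C), sq_nonneg (B ^ 2 - A * W)]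

lemma real_ineq2 (A B C : ℝ) :
    44 * (3 * (A * B ^ 2 * C)) ≤ 22 * B ^ 4 + 198 * (A ^ 2 * C ^ 2) := by
  nlinarith [sq_nonneg (B ^ 2 - 3 * A * C)]

lemma pointwise (u a b c d e v w ws wss : R3)
    (h1 : inner ℝ u u = (1 : ℝ)) (h2 : inner ℝ u a = (0 : ℝ))
    (h4 : inner ℝ u c = -3 * inner ℝ a b)
    (h5 : inner ℝ u d = -4 * inner ℝ a c - 3 * inner ℝ b b)
    (hv : v = cross3 u b) (hw : w = cross3 u c + cross3 a b) :
    2 * inner ℝ c (cross3 u e + (3 : ℝ) • cross3 a d + (2 : ℝ) • cross3 b c)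
    + 2 * inner ℝ w (cross3 w b + cross3 v c + cross3 a ws + cross3 u wss)
    ≤ fluxD u a b c d e w ws wss + 245 * ‖a‖ ^ 2 * (‖c‖ ^ 2 + ‖w‖ ^ 2) := by
  have hu : ‖u‖ = 1 := by
    have := real_inner_self_eq_norm_sq u
    rw [h1] at this
    nlinarith [norm_nonneg u]
  rw [alg1, alg2, fluxD]
  have e3 := alg3 u a c d h1 h2
  rw [h4, h5] at e3
  have e5 := alg5 u a b c
  rw [← hw] at e5
  have e4 := alg4 u b c w
  rw [← hv, e5, h4] at e4
  rw [e4]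
  have hb : inner ℝ b b = ‖b‖ ^ 2 := real_inner_self_eq_norm_sq b
  have mb : ∀ {x y X Y : ℝ}, |x| ≤ X → |y| ≤ Y → |x * y| ≤ X * Y := fun {x y X Y} hx hy => by
    rw [abs_mul]; exact mul_le_mul hx hy (abs_nonneg _) ((abs_nonneg _).trans hx)
  have Iab := abs_real_inner_le_norm a b
  have Iac := abs_real_inner_le_norm a c
  have Ibc := abs_real_inner_le_norm b c
  have Iwb := abs_real_inner_le_norm w b
  have Iuac := abs_inner_cross_le u a c
  have Iubc := abs_inner_cross_le u b c
  have Iuab := abs_inner_cross_le u a b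
  rw [hu, one_mul] at Iuac Iubc Iuab
  have Ibb : |inner ℝ b b| ≤ ‖b‖ ^ 2 := by rw [hb, abs_of_nonneg (by positivity)]
  have T1 := (abs_le.1 (mb Ibb Iuac)).2
  have T2 := (abs_le.1 (mb Iac Iuac)).2
  have T3 := (abs_le.1 (mb Iab Iubc)).2
  have T4 := (abs_le.1 (mb Iab Iwb)).1
  have T5 := (abs_le.1 (mb Ibc Iuab)).1
  have T6 := (abs_le.1 (mb Ibc Iab)).1
  have T7 := (abs_le.1 (mb Ibb Iac)).1
  have T8 : inner ℝ b b * inner ℝ b b = ‖b‖ ^ 4 := by rw [hb]; ring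
  have R1 := real_ineq ‖a‖ ‖b‖ ‖c‖ ‖w‖
  have R2 := real_ineq2 ‖a‖ ‖b‖ ‖c‖
  have P : 0 ≤ ‖a‖ ^ 2 * ‖w‖ ^ 2 := by positivity
  generalize (inner ℝ a b : ℝ) = ab at *
  generalize (inner ℝ a c : ℝ) = ac at *
  generalize (inner ℝ b c : ℝ) = bc at *
  generalize (inner ℝ b b : ℝ) = bb at *
  generalize (inner ℝ w b : ℝ) = wb at *
  generalize (inner ℝ u (cross3 a c) : ℝ) = uac at *
  generalize (inner ℝ u (cross3 b c) : ℝ) = ubc at *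
  generalize (inner ℝ u (cross3 a b) : ℝ) = uab at *
  ring_nf at *
  linarith

section calc2
variable {E : Type*} [NormedAddCommGroup E] [NormedSpace ℝ E]

/-- Space derivative. -/
def Ds (F : ℝ → ℝ → E) : ℝ → ℝ → E := fun t s => deriv (F t) s

/-- Time derivative. -/
def Dt (F : ℝ → ℝ → E) : ℝ → ℝ → E := fun t s => deriv (fun τ => F τ s) t

/-- Joint smoothness. -/
def Sm (F : ℝ → ℝ → E) : Prop := ContDiff ℝ (⊤ : ℕ∞) (fun p : ℝ × ℝ => F p.1 p.2)

lemma Sm.hasFDerivAt {F : ℝ → ℝ → E} (h : Sm F) (p : ℝ × ℝ) :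
    HasFDerivAt (fun p : ℝ × ℝ => F p.1 p.2) (fderiv ℝ (fun p : ℝ × ℝ => F p.1 p.2) p) p :=
  (ContDiff.differentiable h (by simp) p).hasFDerivAt

lemma Sm.hasDerivAt_s' {F : ℝ → ℝ → E} (h : Sm F) (t s : ℝ) :
    HasDerivAt (F t) (fderiv ℝ (fun p : ℝ × ℝ => F p.1 p.2) (t, s) (0, 1)) s :=
  (h.hasFDerivAt (t, s)).comp_hasDerivAt s
    ((hasDerivAt_const s t).prodMk (hasDerivAt_id s))

lemma Sm.hasDerivAt_t' {F : ℝ → ℝ → E} (h : Sm F) (t s : ℝ) :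
    HasDerivAt (fun τ => F τ s) (fderiv ℝ (fun p : ℝ × ℝ => F p.1 p.2) (t, s) (1, 0)) t :=
  HasFDerivAt.comp_hasDerivAt (f := fun τ : ℝ => (τ, s)) t (h.hasFDerivAt (t, s))
    ((hasDerivAt_id t).prodMk (hasDerivAt_const t s))

lemma Sm.Ds_eq {F : ℝ → ℝ → E} (h : Sm F) (t s : ℝ) :
    Ds F t s = fderiv ℝ (fun p : ℝ × ℝ => F p.1 p.2) (t, s) (0, 1) := (h.hasDerivAt_s' t s).deriv

lemma Sm.Dt_eq {F : ℝ → ℝ → E} (h : Sm F) (t s : ℝ) :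
    Dt F t s = fderiv ℝ (fun p : ℝ × ℝ => F p.1 p.2) (t, s) (1, 0) := (h.hasDerivAt_t' t s).deriv

lemma Sm.hasDerivAt_s {F : ℝ → ℝ → E} (h : Sm F) (t s : ℝ) : HasDerivAt (F t) (Ds F t s) s := by
  rw [h.Ds_eq]; exact h.hasDerivAt_s' t s

lemma Sm.hasDerivAt_t {F : ℝ → ℝ → E} (h : Sm F) (t s : ℝ) :
    HasDerivAt (fun τ => F τ s) (Dt F t s) t := by
  rw [h.Dt_eq]; exact h.hasDerivAt_t' t s

lemma Sm.fd {F : ℝ → ℝ → E} (h : Sm F) :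
    ContDiff ℝ (⊤ : ℕ∞) (fderiv ℝ (fun p : ℝ × ℝ => F p.1 p.2)) :=
  ContDiff.fderiv_right (m := (⊤ : ℕ∞)) h (by simp)

lemma Sm.Ds {F : ℝ → ℝ → E} (h : Sm F) : Sm (Ds F) := by
  have : ContDiff ℝ (⊤ : ℕ∞) (fun p => fderiv ℝ (fun p : ℝ × ℝ => F p.1 p.2) p (0, 1)) :=
    h.fd.clm_apply contDiff_const
  unfold Sm
  convert this using 2 with p
  exact h.Ds_eq p.1 p.2

lemma Sm.Dt {F : ℝ → ℝ → E} (h : Sm F) : Sm (Dt F) := by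
  have : ContDiff ℝ (⊤ : ℕ∞) (fun p => fderiv ℝ (fun p : ℝ × ℝ => F p.1 p.2) p (1, 0)) :=
    h.fd.clm_apply contDiff_const
  unfold Sm
  convert this using 2 with p
  exact h.Dt_eq p.1 p.2

lemma Sm.Dt_Ds {F : ℝ → ℝ → E} (h : Sm F) : _root_.Dt (_root_.Ds F) = _root_.Ds (_root_.Dt F) := by
  funext t s
  rw [h.Ds.Dt_eq, h.Dt.Ds_eq]
  have e1 : (fun p : ℝ × ℝ => _root_.Ds F p.1 p.2) =
      fun p => fderiv ℝ (fun p : ℝ × ℝ => F p.1 p.2) p (0, 1) := by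
    funext p; exact h.Ds_eq p.1 p.2
  have e2 : (fun p : ℝ × ℝ => _root_.Dt F p.1 p.2) =
      fun p => fderiv ℝ (fun p : ℝ × ℝ => F p.1 p.2) p (1, 0) := by
    funext p; exact h.Dt_eq p.1 p.2
  rw [e1, e2]
  have hd : DifferentiableAt ℝ (fderiv ℝ (fun p : ℝ × ℝ => F p.1 p.2)) (t, s) :=
    h.fd.differentiable (by simp) _
  have key : ∀ x y : ℝ × ℝ, fderiv ℝ (fun p => fderiv ℝ (fun p : ℝ × ℝ => F p.1 p.2) p x) (t, s) y
      = fderiv ℝ (fderiv ℝ (fun p : ℝ × ℝ => F p.1 p.2)) (t, s) y x := by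
    intro x y
    have := (hd.hasFDerivAt.clm_apply (hasFDerivAt_const x (t, s))).fderiv
    rw [this]; simp
  rw [key, key]
  exact (ContDiffAt.isSymmSndFDerivAt (ContDiff.contDiffAt h) (by
    rw [minSmoothness_of_isRCLikeNormedField]; exact ENat.LEInfty.out)).eq _ _

lemma Sm.cont_s {F : ℝ → ℝ → E} (h : Sm F) (t : ℝ) : Continuous (F t) :=
  (ContDiff.continuous h).comp (Continuous.prodMk continuous_const continuous_id)

lemma Ds_periodic {F : ℝ → ℝ → E} {l : ℝ} (h : ∀ t s, F t (s + l) = F t s) :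
    ∀ t s, Ds F t (s + l) = Ds F t s := by
  intro t s
  unfold Ds
  rw [← deriv_comp_add_const]
  simp only [h]

lemma Sm.leibniz {f : ℝ → ℝ → ℝ} (h : Sm f) (l t : ℝ) :
    HasDerivAt (fun τ => ∫ s in (0:ℝ)..l, f τ s) (∫ s in (0:ℝ)..l, _root_.Dt f t s) t := by
  have hc : Continuous (fun p : ℝ × ℝ => _root_.Dt f p.1 p.2) := ContDiff.continuous h.Dt
  obtain ⟨M, hM⟩ := ((isCompact_Icc (a := t - 1) (b := t + 1)).prod
    (isCompact_uIcc (a := 0) (b := l))).exists_bound_of_continuousOn hc.continuousOn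
  refine (intervalIntegral.hasDerivAt_integral_of_dominated_loc_of_deriv_le
    (F' := _root_.Dt f) (bound := fun _ => M) (s := Set.Icc (t - 1) (t + 1))
    (Icc_mem_nhds (by linarith) (by linarith)) ?_ ?_ ?_ ?_ ?_ ?_).2
  · exact Filter.Eventually.of_forall fun x => (h.cont_s x).aestronglyMeasurable
  · exact (h.cont_s t).intervalIntegrable _ _
  · exact (h.Dt.cont_s t).aestronglyMeasurable
  · refine Filter.Eventually.of_forall fun s hs x hx => ?_
    exact hM (x, s) ⟨hx, Set.uIoc_subset_uIcc hs⟩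
  · exact intervalIntegrable_const
  · exact Filter.Eventually.of_forall fun s _ x _ => h.hasDerivAt_t x s

lemma sup_bound {u a b : ℝ → E} [CompleteSpace E] {l : ℝ} (hl : 0 < l)
    (hu : ∀ s, HasDerivAt u (a s) s) (ha : ∀ s, HasDerivAt a (b s) s) (hb : Continuous b)
    (hp : u l = u 0) (x : ℝ) (hx : x ∈ Set.Icc 0 l) :
    ‖a x‖ ^ 2 ≤ l * ∫ s in (0:ℝ)..l, ‖b s‖ ^ 2 := by
  have hac : Continuous a := continuous_iff_continuousAt.2 fun s => (ha s).continuousAt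
  have h0 : ∫ s in (0:ℝ)..l, a s = 0 := by
    rw [intervalIntegral.integral_eq_sub_of_hasDerivAt (fun s _ => hu s)
      (hac.intervalIntegrable _ _), hp, sub_self]
  set N := ∫ s in (0:ℝ)..l, ‖b s‖ with hN
  have hbn : Continuous fun s => ‖b s‖ := hb.norm
  have hd : ∀ y ∈ Set.Icc 0 l, ‖a x - a y‖ ≤ N := by
    intro y hy
    rw [← intervalIntegral.integral_eq_sub_of_hasDerivAt (fun s _ => ha s)
      (hb.intervalIntegrable y x)]
    refine intervalIntegral.norm_integral_le_abs_integral_norm.trans ?_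
    rw [hN]
    refine (intervalIntegral.abs_integral_mono_interval (c := 0) (d := l) ?_ ?_ ?_).trans (le_of_eq ?_)
    · rw [Set.uIoc_of_le hl.le]
      exact Set.Ioc_subset_Ioc (le_min hy.1 hx.1) (max_le hy.2 hx.2)
    · exact Filter.Eventually.of_forall fun s => norm_nonneg _
    · exact hbn.intervalIntegrable _ _
    · exact abs_of_nonneg (intervalIntegral.integral_nonneg hl.le fun s _ => norm_nonneg _)
  have h1 : ∫ y in (0:ℝ)..l, (a x - a y) = l • a x := by
    rw [intervalIntegral.integral_sub intervalIntegrable_const (hac.intervalIntegrable _ _), h0]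
    simp
  have h2 : ‖∫ y in (0:ℝ)..l, (a x - a y)‖ ≤ N * |l - 0| := by
    apply intervalIntegral.norm_integral_le_of_norm_le_const
    intro y hy
    rw [Set.uIoc_of_le hl.le] at hy
    exact hd y ⟨hy.1.le, hy.2⟩
  rw [h1, norm_smul, sub_zero, Real.norm_eq_abs, abs_of_pos hl, mul_comm] at h2
  have h3 : ‖a x‖ ≤ N := le_of_mul_le_mul_right h2 hl
  have h4 : 0 ≤ ∫ s in (0:ℝ)..l, (‖b s‖ - N / l) ^ 2 :=
    intervalIntegral.integral_nonneg hl.le fun s _ => sq_nonneg _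
  have h5 : ∫ s in (0:ℝ)..l, (‖b s‖ - N / l) ^ 2 =
      (∫ s in (0:ℝ)..l, ‖b s‖ ^ 2) - 2 * (N / l) * N + l * (N / l) ^ 2 := by
    have e : ∀ s, (‖b s‖ - N / l) ^ 2 = ‖b s‖ ^ 2 - 2 * (N / l) * ‖b s‖ + (N / l) ^ 2 := fun s => by
      ring
    simp only [e]
    rw [intervalIntegral.integral_add, intervalIntegral.integral_sub,
      intervalIntegral.integral_const_mul, ← hN]
    · simp
    all_goals exact Continuous.intervalIntegrable (by fun_prop) _ _
  rw [h5] at h4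
  have h6 : l * ((∫ s in (0:ℝ)..l, ‖b s‖ ^ 2) - 2 * (N / l) * N + l * (N / l) ^ 2) =
      l * (∫ s in (0:ℝ)..l, ‖b s‖ ^ 2) - N ^ 2 := by
    field_simp; ring
  have h7 := mul_nonneg hl.le h4
  rw [h6] at h7
  nlinarith [norm_nonneg (a x)]

end calc2

lemma eq_zero_of_hasDerivAt {f : ℝ → ℝ} {k f' s : ℝ} (hf : ∀ x, f x = k)
    (h : HasDerivAt f f' s) : f' = 0 := by
  have : f = fun _ => k := funext hf
  rw [this] at h
  exact h.unique (hasDerivAt_const s k)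

@[fun_prop]
lemma Continuous.cross3 {X : Type*} [TopologicalSpace X] {f g : X → R3}
    (hf : Continuous f) (hg : Continuous g) :
    Continuous (fun y => _root_.cross3 (f y) (g y)) := by
  unfold _root_.cross3 toE
  refine (EuclideanSpace.equiv (Fin 3) ℝ).symm.continuous.comp ?_
  refine continuous_pi fun i => ?_
  fin_cases i <;> simp <;> fun_prop

/-- Constraints from `|u| = 1`. -/
lemma constraints {u a b c d : ℝ → R3} (hn : ∀ s, ‖u s‖ = 1)
    (ha : ∀ s, HasDerivAt u (a s) s) (hb : ∀ s, HasDerivAt a (b s) s)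
    (hc : ∀ s, HasDerivAt b (c s) s) (hd : ∀ s, HasDerivAt c (d s) s) (s : ℝ) :
    inner ℝ (u s) (u s) = (1 : ℝ) ∧ inner ℝ (u s) (a s) = (0 : ℝ) ∧
    inner ℝ (u s) (c s) = -3 * inner ℝ (a s) (b s) ∧
    inner ℝ (u s) (d s) = -4 * inner ℝ (a s) (c s) - 3 * inner ℝ (b s) (b s) := by
  have h1 : ∀ s, inner ℝ (u s) (u s) = (1 : ℝ) := fun s => by
    rw [real_inner_self_eq_norm_sq, hn]; norm_num
  have h2 : ∀ s, inner ℝ (u s) (a s) = (0 : ℝ) := fun s => by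
    have := eq_zero_of_hasDerivAt h1 ((ha s).inner ℝ (ha s))
    rw [real_inner_comm (u s) (a s)] at this
    linarith
  have h3 : ∀ s, inner ℝ (u s) (b s) + inner ℝ (a s) (a s) = (0 : ℝ) := fun s =>
    eq_zero_of_hasDerivAt h2 ((ha s).inner ℝ (hb s))
  have h4 : ∀ s, inner ℝ (u s) (c s) + 3 * inner ℝ (a s) (b s) = (0 : ℝ) := fun s => by
    have := eq_zero_of_hasDerivAt h3 (((ha s).inner ℝ (hc s)).add ((hb s).inner ℝ (hb s)))
    rw [real_inner_comm (a s) (b s)] at this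
    linarith
  have h5 : inner ℝ (u s) (d s) + 4 * inner ℝ (a s) (c s) + 3 * inner ℝ (b s) (b s) = (0 : ℝ) := by
    have := eq_zero_of_hasDerivAt h4
      (((ha s).inner ℝ (hd s)).add (((hb s).inner ℝ (hc s)).const_mul 3))
    linarith
  exact ⟨h1 s, h2 s, by linarith [h4 s], by linarith⟩

/-- The flux. -/
def flux (u a b c d w ws : R3) : ℝ :=
  2 * inner ℝ c (cross3 u d) + 2 * inner ℝ w (cross3 u ws)
  - 12 * (inner ℝ a b * inner ℝ u (cross3 a c)) + 44 * (inner ℝ b b * inner ℝ a b)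

lemma flux_hasDerivAt {u a b c d w ws : ℝ → R3} {e wss : R3} {s : ℝ}
    (ha : HasDerivAt u (a s) s) (hb : HasDerivAt a (b s) s)
    (hc : HasDerivAt b (c s) s) (hd : HasDerivAt c (d s) s) (he : HasDerivAt d e s)
    (hw : HasDerivAt w (ws s) s) (hws : HasDerivAt ws wss s) :
    HasDerivAt (fun x => flux (u x) (a x) (b x) (c x) (d x) (w x) (ws x))
      (fluxD (u s) (a s) (b s) (c s) (d s) e (w s) (ws s) wss) s := by
  unfold flux fluxD
  refine (((((hd.inner ℝ (ha.cross3 he)).const_mul 2).add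
    ((hw.inner ℝ (ha.cross3 hws)).const_mul 2)).sub
    (((hb.inner ℝ hc).mul (ha.inner ℝ (hb.cross3 hd))).const_mul 12)).add
    (((hc.inner ℝ hc).mul (hb.inner ℝ hc)).const_mul 44)).congr_deriv ?_
  simp only [inner_add_right]
  have z : inner ℝ (a s) (cross3 (a s) (c s)) = (0 : ℝ) := by
    simp only [inner_R3, cross3_0, cross3_1, cross3_2]; ring
  rw [z, real_inner_comm (b s) (c s)]
  ring

lemma wss_eq (u a b c d e : R3) :
    ((cross3 u e + cross3 a d) + (cross3 a d + cross3 b c)) +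
      ((cross3 a d + cross3 b c) + (cross3 b c + cross3 c b))
    = cross3 u e + (3 : ℝ) • cross3 a d + (2 : ℝ) • cross3 b c := by
  apply R3_ext <;>
  · simp only [PiLp.add_apply, PiLp.smul_apply, smul_eq_mul, cross3_0, cross3_1, cross3_2]
    ring

lemma core {u : ℝ → ℝ → R3} (hu : Sm u) (hn : ∀ t s, ‖u t s‖ = 1)
    (heq : ∀ t s, Dt u t s = deriv (fun σ => cross3 (u t σ) (deriv (u t) σ)) s) (t s : ℝ) :
    2 * inner ℝ (Ds (Ds (Ds u)) t s) (Dt (Ds (Ds (Ds u))) t s)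
    + 2 * inner ℝ (Dt (Ds u) t s) (Dt (Dt (Ds u)) t s) ≤
      fluxD (u t s) (Ds u t s) (Ds (Ds u) t s) (Ds (Ds (Ds u)) t s) (Ds (Ds (Ds (Ds u))) t s)
        (Ds (Ds (Ds (Ds (Ds u)))) t s) (Dt (Ds u) t s) (Ds (Dt (Ds u)) t s)
        (Ds (Ds (Dt (Ds u))) t s)
      + 245 * ‖Ds u t s‖ ^ 2 * (‖Ds (Ds (Ds u)) t s‖ ^ 2 + ‖Dt (Ds u) t s‖ ^ 2) := by
  have ha := hu.Ds
  have hb := ha.Ds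
  have hc := hb.Ds
  have hd := hc.Ds
  have hv := hu.Dt
  have hw := ha.Dt
  have hws := hw.Ds
  have Eda : Dt (Ds u) = Ds (Dt u) := hu.Dt_Ds
  have Edb : Dt (Ds (Ds u)) = Ds (Dt (Ds u)) := ha.Dt_Ds
  have Edc : Dt (Ds (Ds (Ds u))) = Ds (Ds (Dt (Ds u))) := by rw [hb.Dt_Ds, Edb]
  -- shorthand
  generalize hA : Ds u = a at *
  generalize hB : Ds a = b at *
  generalize hC : Ds b = c at *
  generalize hD : Ds c = d at *
  generalize hE : Ds d = e at *
  generalize hV : Dt u = v at *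
  generalize hW : Dt a = w at *
  generalize hWS : Ds w = ws at *
  generalize hWSS : Ds ws = wss at *
  have Da : ∀ t s, HasDerivAt (u t) (a t s) s := fun t s => hA ▸ hu.hasDerivAt_s t s
  have Db : ∀ t s, HasDerivAt (a t) (b t s) s := fun t s => hB ▸ ha.hasDerivAt_s t s
  have Dc : ∀ t s, HasDerivAt (b t) (c t s) s := fun t s => hC ▸ hb.hasDerivAt_s t s
  have Dd : ∀ t s, HasDerivAt (c t) (d t s) s := fun t s => hD ▸ hc.hasDerivAt_s t s
  have De : ∀ t s, HasDerivAt (d t) (e t s) s := fun t s => hE ▸ hd.hasDerivAt_s t s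
  have Dw : ∀ t s, HasDerivAt (v t) (w t s) s := fun t s => Eda ▸ hv.hasDerivAt_s t s
  have Dws : ∀ t s, HasDerivAt (w t) (ws t s) s := fun t s => hWS ▸ hw.hasDerivAt_s t s
  have Dwss : ∀ t s, HasDerivAt (ws t) (wss t s) s := fun t s => hWSS ▸ hws.hasDerivAt_s t s
  have Dv : ∀ t s, HasDerivAt (fun τ => u τ s) (v t s) t := fun t s => hV ▸ hu.hasDerivAt_t t s
  have Dbt : ∀ t s, HasDerivAt (fun τ => b τ s) (ws t s) t := fun t s => Edb ▸ hb.hasDerivAt_t t s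
  have Ev : ∀ t s, v t s = cross3 (u t s) (b t s) := by
    intro t s
    have e1 : (fun σ => cross3 (u t σ) (deriv (u t) σ)) = fun σ => cross3 (u t σ) (a t σ) := by
      funext σ; rw [(Da t σ).deriv]
    rw [heq, e1, ((Da t s).cross3 (Db t s)).deriv]
    apply R3_ext <;>
    · simp only [PiLp.add_apply, cross3_0, cross3_1, cross3_2]
      ring
  have Ev' : ∀ t, v t = fun s => cross3 (u t s) (b t s) := fun t => funext (Ev t)
  have Ew : ∀ t s, w t s = cross3 (u t s) (c t s) + cross3 (a t s) (b t s) := fun t s => by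
    have := Dw t s
    rw [Ev' t] at this
    exact this.unique ((Da t s).cross3 (Dc t s))
  have Ew' : ∀ t, w t = fun s => cross3 (u t s) (c t s) + cross3 (a t s) (b t s) :=
    fun t => funext (Ew t)
  have Ews : ∀ t s, ws t s = (cross3 (u t s) (d t s) + cross3 (a t s) (c t s)) +
      (cross3 (a t s) (c t s) + cross3 (b t s) (b t s)) := fun t s => by
    have := Dws t s
    rw [Ew' t] at this
    exact this.unique (((Da t s).cross3 (Dd t s)).add ((Db t s).cross3 (Dc t s)))
  have Ewss : wss t s = cross3 (u t s) (e t s) + (3 : ℝ) • cross3 (a t s) (d t s)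
      + (2 : ℝ) • cross3 (b t s) (c t s) := by
    have := Dwss t s
    rw [show ws t = _ from funext (Ews t)] at this
    rw [← wss_eq]
    exact this.unique ((((Da t s).cross3 (De t s)).add ((Db t s).cross3 (Dd t s))).add
      (((Db t s).cross3 (Dd t s)).add ((Dc t s).cross3 (Dc t s))))
  have Evt : ∀ t s, Dt v t s = cross3 (u t s) (ws t s) + cross3 (v t s) (b t s) := fun t s => by
    have h1 := hv.hasDerivAt_t t s
    rw [show (fun τ => v τ s) = fun τ => cross3 (u τ s) (b τ s) from funext fun τ => Ev τ s] at h1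
    exact h1.unique ((Dv t s).cross3 (Dbt t s))
  have Ewt : Dt w t s = cross3 (w t s) (b t s) + cross3 (v t s) (c t s) + cross3 (a t s) (ws t s)
      + cross3 (u t s) (wss t s) := by
    rw [Eda, hv.Dt_Ds]
    have h1 := hv.Dt.hasDerivAt_s t s
    rw [show Dt v t = _ from funext (Evt t)] at h1
    have h2 := h1.unique (((Da t s).cross3 (Dwss t s)).add ((Dw t s).cross3 (Dc t s)))
    rw [h2, ← Eda]
    abel
  obtain ⟨c1, c2, c4, c5⟩ := constraints (hn t) (Da t) (Db t) (Dc t) (Dd t) s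
  have := pointwise (u t s) (a t s) (b t s) (c t s) (d t s) (e t s) (v t s) (w t s) (ws t s)
    (wss t s) c1 c2 c4 c5 (Ev t s) (Ew t s)
  rw [Edc, Ewt, Ewss] at *
  exact this

/-- Lemma A.3: differential inequality for the `H³`-level
quantity. -/
theorem stmt16
    (ℓ : ℝ) (hℓ : 0 < ℓ) :
    ∃ C : ℝ, 0 < C ∧
      ∀ u : ℝ → ℝ → R3,
        ContDiff ℝ (⊤ : ℕ∞) (fun p : ℝ × ℝ => u p.1 p.2) →
        (∀ t s : ℝ, u t (s + ℓ) = u t s) →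
        (∀ t s : ℝ, ‖u t s‖ = 1) →
        (∀ t s : ℝ,
          deriv (fun τ => u τ s) t =
            deriv (fun σ => cross3 (u t σ) (deriv (u t) σ)) s) →
        ∀ t : ℝ,
          deriv (fun τ =>
            (∫ s in (0:ℝ)..ℓ, ‖deriv (deriv (deriv (u τ))) s‖ ^ 2)
              + ∫ s in (0:ℝ)..ℓ, ‖deriv (fun τ' => deriv (u τ') s) τ‖ ^ 2) t ≤
          C * (∫ s in (0:ℝ)..ℓ, ‖deriv (deriv (u t)) s‖ ^ 2) *
            ((∫ s in (0:ℝ)..ℓ, ‖deriv (deriv (deriv (u t))) s‖ ^ 2)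
              + ∫ s in (0:ℝ)..ℓ, ‖deriv (fun τ => deriv (u τ) s) t‖ ^ 2) := by
  refine ⟨245 * ℓ, by positivity, ?_⟩
  intro u hu hper hn heq t
  replace hu : Sm u := hu
  have ha := hu.Ds
  have hb := ha.Ds
  have hc := hb.Ds
  have hd := hc.Ds
  have he := hd.Ds
  have hw := ha.Dt
  have hws := hw.Ds
  have hwss := hws.Ds
  change deriv (fun τ => (∫ s in (0:ℝ)..ℓ, ‖Ds (Ds (Ds u)) τ s‖ ^ 2)
      + ∫ s in (0:ℝ)..ℓ, ‖Dt (Ds u) τ s‖ ^ 2) t ≤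
    245 * ℓ * (∫ s in (0:ℝ)..ℓ, ‖Ds (Ds u) t s‖ ^ 2) *
      ((∫ s in (0:ℝ)..ℓ, ‖Ds (Ds (Ds u)) t s‖ ^ 2) + ∫ s in (0:ℝ)..ℓ, ‖Dt (Ds u) t s‖ ^ 2)
  have hf : Sm (fun τ s => ‖Ds (Ds (Ds u)) τ s‖ ^ 2) := ContDiff.norm_sq ℝ hc
  have hg : Sm (fun τ s => ‖Dt (Ds u) τ s‖ ^ 2) := ContDiff.norm_sq ℝ hw
  rw [((hf.leibniz ℓ t).fun_add (hg.leibniz ℓ t)).deriv]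
  have cf := hf.Dt.cont_s t
  have cg := hg.Dt.cont_s t
  rw [← intervalIntegral.integral_add (cf.intervalIntegrable _ _) (cg.intervalIntegrable _ _)]
  have c0 := hu.cont_s t
  have ca := ha.cont_s t
  have cb := hb.cont_s t
  have cc := hc.cont_s t
  have cd := hd.cont_s t
  have ce := he.cont_s t
  have cw := hw.cont_s t
  have cws := hws.cont_s t
  have cwss := hwss.cont_s t
  have pa := Ds_periodic hper
  have pb := Ds_periodic pa
  have pc := Ds_periodic pb
  have pd := Ds_periodic pc
  have pw : ∀ t s, Dt (Ds u) t (s + ℓ) = Dt (Ds u) t s := fun t s => by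
    unfold Dt; simp only [pa]
  have pws := Ds_periodic pw
  set B := ∫ s in (0:ℝ)..ℓ, ‖Ds (Ds u) t s‖ ^ 2 with hB
  have hsup := sup_bound hℓ (hu.hasDerivAt_s t) (ha.hasDerivAt_s t) cb
    (by simpa using hper t 0)
  rw [← hB] at hsup
  set FD : ℝ → ℝ := fun s => fluxD (u t s) (Ds u t s) (Ds (Ds u) t s) (Ds (Ds (Ds u)) t s)
        (Ds (Ds (Ds (Ds u))) t s)
        (Ds (Ds (Ds (Ds (Ds u)))) t s) (Dt (Ds u) t s) (Ds (Dt (Ds u)) t s)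
        (Ds (Ds (Dt (Ds u))) t s) with hFD
  have cFD : Continuous FD := by
    rw [hFD]; unfold fluxD
    fun_prop
  have hFDint : ∫ s in (0:ℝ)..ℓ, FD s = 0 := by
    rw [intervalIntegral.integral_eq_sub_of_hasDerivAt (fun s _ =>
      flux_hasDerivAt (hu.hasDerivAt_s t s) (ha.hasDerivAt_s t s) (hb.hasDerivAt_s t s)
        (hc.hasDerivAt_s t s) (hd.hasDerivAt_s t s) (hw.hasDerivAt_s t s)
        (hws.hasDerivAt_s t s)) (cFD.intervalIntegrable _ _)]
    have z : ℓ = 0 + ℓ := by ring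
    rw [z, hper, pa, pb, pc, pd, pw, pws, sub_self]
  have hpt : ∀ s ∈ Set.Icc 0 ℓ,
      Dt (fun τ s => ‖Ds (Ds (Ds u)) τ s‖ ^ 2) t s + Dt (fun τ s => ‖Dt (Ds u) τ s‖ ^ 2) t s
      ≤ FD s + 245 * ℓ * B * (‖Ds (Ds (Ds u)) t s‖ ^ 2 + ‖Dt (Ds u) t s‖ ^ 2) := by
    intro s hs
    have e1 : Dt (fun τ s => ‖Ds (Ds (Ds u)) τ s‖ ^ 2) t s =
        2 * inner ℝ (Ds (Ds (Ds u)) t s) (Dt (Ds (Ds (Ds u))) t s) :=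
      (hc.hasDerivAt_t t s).norm_sq.deriv
    have e2 : Dt (fun τ s => ‖Dt (Ds u) τ s‖ ^ 2) t s =
        2 * inner ℝ (Dt (Ds u) t s) (Dt (Dt (Ds u)) t s) :=
      (hw.hasDerivAt_t t s).norm_sq.deriv
    rw [e1, e2]
    refine (core hu hn heq t s).trans ?_
    have h1 := hsup s hs
    have h2 : 0 ≤ ‖Ds (Ds (Ds u)) t s‖ ^ 2 + ‖Dt (Ds u) t s‖ ^ 2 := by positivity
    have h3 := mul_le_mul_of_nonneg_right h1 h2
    simp only [hFD]
    linarith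
  refine (intervalIntegral.integral_mono_on hℓ.le ((cf.add cg).intervalIntegrable _ _)
    (Continuous.intervalIntegrable (by fun_prop) _ _) hpt).trans (le_of_eq ?_)
  rw [intervalIntegral.integral_add (cFD.intervalIntegrable _ _)
    (Continuous.intervalIntegrable (by fun_prop) _ _), hFDint,
    intervalIntegral.integral_const_mul, intervalIntegral.integral_add
      (Continuous.intervalIntegrable (by fun_prop) _ _)
      (Continuous.intervalIntegrable (by fun_prop) _ _), zero_add]
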